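/- arXiv:1802.07109 — 2 statements merged into one kernel-verified Lean document; each statement's English description precedes it below -/
import Mathlib

section
/- Let A be a complete normed unital ring that is a normed algebra over ℝ, and let x, y : ℝ → A be functions with x(0) = y(0) = 1 that are differentiable at 0 with derivatives X and Y respectively. Then the limit, as t tends to 0 from the right, of t⁻¹ · (x(√t)⁻¹ y(√t)⁻¹ x(√t) y(√t) − 1) exists and equals XY − YX, where for s close enough to 0 the elements x(s) and y(s) are invertible (being close to 1 in a complete normed ring) and inverses not defined by invertibility may be interpreted via the everywhere-defined ring inverse operation. -/
open Filter Topology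

/-- If `u` and `v` are units, the group commutator deviates from `1` by the ring commutator of
`u - 1` and `v - 1`, up to a unit factor. -/
theorem Ring.inverse_mul_inverse_mul_mul_sub_one {R : Type*} [Ring R] {u v : R}
    (hu : IsUnit u) (hv : IsUnit v) :
    Ring.inverse u * Ring.inverse v * u * v - 1 =
      Ring.inverse u * Ring.inverse v * ((u - 1) * (v - 1) - (v - 1) * (u - 1)) := by
  have h : Ring.inverse u * Ring.inverse v * (v * u) = 1 := by
    rw [mul_assoc, Ring.inverse_mul_cancel_left _ _ hv, Ring.inverse_mul_cancel _ hu]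
  have hcomm : (u - 1) * (v - 1) - (v - 1) * (u - 1) = u * v - v * u := by noncomm_ring
  rw [hcomm, mul_sub, h, mul_assoc _ u v]

theorem tendsto_ringInverse_one {A α : Type*} [NormedRing A] [CompleteSpace A] {l : Filter α}
    {f : α → A} (hf : Tendsto f l (𝓝 1)) : Tendsto (fun a => Ring.inverse (f a)) l (𝓝 1) := by
  have h := (NormedRing.inverse_continuousAt (1 : Aˣ)).tendsto
  rw [Units.val_one, Ring.inverse_one] at h
  exact h.comp hf

/-- The limit of the rescaled group commutator of two curves through `1`, before the substitution
`s = √t`. -/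
theorem tendsto_inv_sq_smul_commutator {A : Type*} [NormedRing A] [CompleteSpace A]
    [NormedAlgebra ℝ A] {x y : ℝ → A} {X Y : A} (hx0 : x 0 = 1) (hy0 : y 0 = 1)
    (hx : HasDerivAt x X 0) (hy : HasDerivAt y Y 0) :
    Tendsto (fun s : ℝ => (s ^ 2)⁻¹ •
        (Ring.inverse (x s) * Ring.inverse (y s) * x s * y s - 1))
      (𝓝[≠] 0) (𝓝 (X * Y - Y * X)) := by
  have hxs := hx.tendsto_slope_zero
  have hys := hy.tendsto_slope_zero
  simp only [zero_add, hx0, hy0] at hxs hys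
  have hx1 : Tendsto x (𝓝[≠] 0) (𝓝 1) := hx0 ▸ hx.continuousAt.tendsto.mono_left nhdsWithin_le_nhds
  have hy1 : Tendsto y (𝓝[≠] 0) (𝓝 1) := hy0 ▸ hy.continuousAt.tendsto.mono_left nhdsWithin_le_nhds
  have hlim := ((tendsto_ringInverse_one hx1).mul (tendsto_ringInverse_one hy1)).mul
    ((hxs.mul hys).sub (hys.mul hxs))
  rw [one_mul, one_mul] at hlim
  have hunit : ∀ᶠ a in 𝓝 (1 : A), IsUnit a := Units.nhds (1 : Aˣ)
  refine hlim.congr' ?_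
  filter_upwards [hx1.eventually hunit, hy1.eventually hunit] with s hxu hyu
  rw [Ring.inverse_mul_inverse_mul_mul_sub_one hxu hyu]
  simp only [smul_mul_assoc, mul_smul_comm, ← smul_sub, smul_smul, sq, mul_inv]

/-- If `x, y : ℝ → A` satisfy `x 0 = y 0 = 1` and are differentiable at `0` with
derivatives `X` and `Y`, then `t⁻¹ • (x(√t)⁻¹ y(√t)⁻¹ x(√t) y(√t) - 1) → XY - YX`
as `t → 0⁺`, where inverses are the (junk-valued) ring inverse. -/
theorem stmt_5 {A : Type*} [NormedRing A] [CompleteSpace A] [NormedAlgebra ℝ A]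
    (x y : ℝ → A) (X Y : A) (hx0 : x 0 = 1) (hy0 : y 0 = 1)
    (hx : HasDerivAt x X 0) (hy : HasDerivAt y Y 0) :
    Tendsto (fun t : ℝ => t⁻¹ •
        (Ring.inverse (x (Real.sqrt t)) * Ring.inverse (y (Real.sqrt t)) *
          x (Real.sqrt t) * y (Real.sqrt t) - 1))
      (𝓝[>] 0) (𝓝 (X * Y - Y * X)) := by
  have hsqrt : Tendsto Real.sqrt (𝓝[>] 0) (𝓝[≠] 0) := by
    refine tendsto_nhdsWithin_iff.2 ⟨?_, ?_⟩
    · simpa using (Real.continuous_sqrt.tendsto 0).mono_left nhdsWithin_le_nhds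
    · filter_upwards [self_mem_nhdsWithin] with t ht using (Real.sqrt_pos.2 ht).ne'
  refine ((tendsto_inv_sq_smul_commutator hx0 hy0 hx hy).comp hsqrt).congr' ?_
  filter_upwards [self_mem_nhdsWithin] with t ht
  simp only [Function.comp_apply, Real.sq_sqrt (Set.mem_Ioi.1 ht).le]
end

section
/- Let A be a complete normed unital ring that is a normed algebra over ℝ, and let x, y : ℝ → A be functions with x(0) = y(0) = 1 that are differentiable at 0 with derivatives X and Y respectively. Then the limit, as s tends to 0 with s ≠ 0, of s⁻² · (x(s) y(s) − y(s) x(s)) exists and equals XY − YX. -/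
open Filter Topology

/-- If `x, y : ℝ → A` satisfy `x 0 = y 0 = 1` and are differentiable at `0` with
derivatives `X` and `Y`, then `s⁻² • (x(s)y(s) - y(s)x(s)) → XY - YX` as `s → 0`, `s ≠ 0`. -/
theorem stmt_7 {A : Type*} [NormedRing A] [CompleteSpace A] [NormedAlgebra ℝ A]
    (x y : ℝ → A) (X Y : A) (hx0 : x 0 = 1) (hy0 : y 0 = 1)
    (hx : HasDerivAt x X 0) (hy : HasDerivAt y Y 0) :
    Tendsto (fun s : ℝ => (s ^ 2)⁻¹ • (x s * y s - y s * x s))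
      (𝓝[≠] 0) (𝓝 (X * Y - Y * X)) := by
  have hx' := hasDerivAt_iff_tendsto_slope_zero.mp hx
  have hy' := hasDerivAt_iff_tendsto_slope_zero.mp hy
  simp only [zero_add, hx0, hy0] at hx' hy'
  refine ((hx'.mul hy').sub (hy'.mul hx')).congr fun s => ?_
  rw [smul_mul_smul_comm, smul_mul_smul_comm, ← smul_sub, ← mul_inv, ← sq]
  congr 1
  noncomm_ring
end
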